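/- Let f : ℝ → ℂ be almost periodic, let λ : [0,1] → [0,∞) be continuous, strictly increasing with λ(0) = 0 whose inverse ν is (q+1)-times continuously differentiable for some integer q ≥ 1 with ν^{(j)}(0) = 0 for 1 ≤ j < q and ν^{(q)}(0) ≠ 0, and let g : (0,1] → ℝ be measurable and bounded with lim_{ε→0⁺} g(ε) = g₀ ∈ ℝ. Then lim_{η→0⁺} (1/η) ∫₀^η g(ε) · f(1/λ(ε)) dε = g₀ · M(f). -/

import Mathlib

open Filter MeasureTheory Topology

/-- A trigonometric polynomial `x ↦ Σ_k c_k exp(i λ_k x)` with `c_k ∈ ℂ`, `λ_k ∈ ℝ`. -/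
def IsTrigPoly (g : ℝ → ℂ) : Prop :=
  ∃ (m : ℕ) (c : Fin m → ℂ) (lam : Fin m → ℝ),
    g = fun x : ℝ => ∑ k, c k * Complex.exp (Complex.I * ((lam k * x : ℝ) : ℂ))

/-- A (Bohr) almost periodic function: a uniform limit on `ℝ` of trigonometric polynomials. -/
def AlmostPeriodic (f : ℝ → ℂ) : Prop :=
  ∃ g : ℕ → ℝ → ℂ, (∀ k, IsTrigPoly (g k)) ∧ TendstoUniformly g f atTop

/-- The character `x ↦ exp(i a x)` of frequency `a`. -/
noncomputable def trigExp (a x : ℝ) : ℂ := Complex.exp (Complex.I * ((a * x : ℝ) : ℂ))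

theorem norm_trigExp (a x : ℝ) : ‖trigExp a x‖ = 1 := by
  rw [trigExp, mul_comm, Complex.norm_exp_ofReal_mul_I]

theorem trigExp_zero_left (x : ℝ) : trigExp 0 x = 1 := by simp [trigExp]

theorem continuous_trigExp (a : ℝ) : Continuous (trigExp a) := by
  unfold trigExp; fun_prop

theorem measurable_trigExp_inv (a : ℝ) : Measurable fun s : ℝ => trigExp a (1 / s) :=
  (continuous_trigExp a).measurable.comp (by fun_prop)

theorem tendsto_div_pow_of_iteratedDerivWithin_eq_zero {φ : ℝ → ℝ} {L : ℝ} (hL : 0 < L) {n : ℕ}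
    (hφ : ContDiffOn ℝ n φ (Set.Icc 0 L))
    (hzero : ∀ j < n, iteratedDerivWithin j φ (Set.Icc 0 L) 0 = 0) :
    Tendsto (fun s => φ s / s ^ n) (𝓝[>] 0)
      (𝓝 (iteratedDerivWithin n φ (Set.Icc 0 L) 0 / n.factorial)) := by
  have hle : 𝓝[>] (0 : ℝ) ≤ 𝓝[Set.Icc 0 L] 0 :=
    (nhdsWithin_Ioc_eq_nhdsGT hL).symm.trans_le (nhdsWithin_mono _ Set.Ioc_subset_Icc_self)
  have h := ((taylor_isLittleO (convex_Icc 0 L) ⟨le_rfl, hL.le⟩ hφ).mono hle).tendsto_div_nhds_zero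
  have h' := h.add_const (iteratedDerivWithin n φ (Set.Icc 0 L) 0 / n.factorial)
  rw [zero_add] at h'
  refine h'.congr' ?_
  filter_upwards [self_mem_nhdsWithin] with s hs
  have hs : (s : ℝ) ≠ 0 := ne_of_gt hs
  rw [taylor_within_apply, Finset.sum_range_succ, Finset.sum_eq_zero]
  · have : (n.factorial : ℝ) ≠ 0 := by positivity
    simp only [sub_zero, smul_eq_mul, zero_add]
    field_simp
    ring
  · intro j hj
    rw [hzero j (Finset.mem_range.1 hj), smul_zero]

theorem intervalIntegrable_mul_trigExp_inv {w : ℝ → ℂ} {h : ℝ} (a : ℝ)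
    (hw : IntervalIntegrable w volume 0 h) :
    IntervalIntegrable (fun s => w s * trigExp a (1 / s)) volume 0 h := by
  rw [intervalIntegrable_iff] at hw ⊢
  exact hw.mul_bdd (measurable_trigExp_inv a).aestronglyMeasurable
    (ae_of_all _ fun s => (norm_trigExp a _).le)

theorem norm_integral_pow_mul_trigExp_inv_le (a : ℝ) (p : ℕ) {h : ℝ} (hh : 0 ≤ h) :
    |a| * ‖∫ s in (0 : ℝ)..h, (s : ℂ) ^ p * trigExp a (1 / s)‖ ≤ (p + 3) * h ^ (p + 2) := by
  have hint (k : ℕ) :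
      IntervalIntegrable (fun s : ℝ => (s : ℂ) ^ k * trigExp a (1 / s)) volume 0 h :=
    intervalIntegrable_mul_trigExp_inv a (Continuous.intervalIntegrable (by fun_prop) _ _)
  have hcont : ContinuousOn (fun s : ℝ => (s : ℂ) ^ (p + 2) * trigExp a (1 / s))
      (Set.Icc 0 h) := by
    intro s _
    apply ContinuousAt.continuousWithinAt
    rcases eq_or_ne s 0 with rfl | hs
    · rw [ContinuousAt]
      simp only [Complex.ofReal_zero, ne_eq, Nat.add_eq_zero_iff, OfNat.ofNat_ne_zero, and_false,
        not_false_eq_true, zero_pow, zero_mul]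
      have h0 : Tendsto (fun s : ℝ => |s| ^ (p + 2)) (𝓝 0) (𝓝 0) := by
        have : Continuous fun s : ℝ => |s| ^ (p + 2) := by fun_prop
        simpa using this.tendsto 0
      exact squeeze_zero_norm (fun s => by simp [norm_trigExp]) h0
    · have := (continuous_trigExp a).continuousAt.comp
        (continuousAt_const.div continuousAt_id hs : ContinuousAt (fun s : ℝ => 1 / s) s)
      exact (Continuous.continuousAt (by fun_prop)).mul this
  have hderiv : ∀ s ∈ Set.Ioo 0 h,
      HasDerivAt (fun s : ℝ => (s : ℂ) ^ (p + 2) * trigExp a (1 / s))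
        ((p + 2 : ℂ) * ((s : ℂ) ^ (p + 1) * trigExp a (1 / s)) -
          Complex.I * a * ((s : ℂ) ^ p * trigExp a (1 / s))) s := by
    intro s hs
    have hs0 : s ≠ 0 := hs.1.ne'
    have hs0' : (s : ℂ) ≠ 0 := by exact_mod_cast hs0
    have h1 : HasDerivAt (fun s : ℝ => ((a * (1 / s) : ℝ) : ℂ)) ((a * -(s ^ 2)⁻¹ : ℝ) : ℂ) s := by
      simpa only [one_div] using ((hasDerivAt_inv hs0).const_mul a).ofReal_comp
    have h2 := ((h1.const_mul Complex.I).cexp)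
    have h3 : HasDerivAt (fun s : ℝ => (s : ℂ) ^ (p + 2)) (((p + 2 : ℕ) : ℂ) * (s : ℂ) ^ (p + 1))
        s := by
      exact_mod_cast (hasDerivAt_pow (p + 2) s).ofReal_comp
    refine (h3.mul h2).congr_deriv ?_
    simp only [trigExp]
    push_cast
    field_simp
    ring
  have hsplit := intervalIntegral.integral_eq_sub_of_hasDerivAt_of_le hh hcont hderiv
    (((hint (p + 1)).const_mul _).sub ((hint p).const_mul _))
  rw [intervalIntegral.integral_sub ((hint (p + 1)).const_mul _) ((hint p).const_mul _),
    intervalIntegral.integral_const_mul, intervalIntegral.integral_const_mul] at hsplit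
  have hrem : ‖∫ s in (0 : ℝ)..h, (s : ℂ) ^ (p + 1) * trigExp a (1 / s)‖ ≤ h ^ (p + 1) * |h - 0| := by
    refine intervalIntegral.norm_integral_le_of_norm_le_const fun s hs => ?_
    rw [Set.uIoc_of_le hh] at hs
    simp only [norm_mul, norm_pow, norm_trigExp, mul_one, Complex.norm_real, Real.norm_eq_abs,
      abs_of_pos hs.1]
    exact pow_le_pow_left₀ hs.1.le hs.2 _
  rw [sub_zero, abs_of_nonneg hh] at hrem
  have hmain : Complex.I * a * (∫ s in (0 : ℝ)..h, (s : ℂ) ^ p * trigExp a (1 / s)) =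
      (p + 2 : ℂ) * (∫ s in (0 : ℝ)..h, (s : ℂ) ^ (p + 1) * trigExp a (1 / s)) -
        (h : ℂ) ^ (p + 2) * trigExp a (1 / h) := by
    simp at hsplit
    simp only [one_div]
    linear_combination -hsplit
  calc |a| * ‖∫ s in (0 : ℝ)..h, (s : ℂ) ^ p * trigExp a (1 / s)‖
      = ‖Complex.I * a * (∫ s in (0 : ℝ)..h, (s : ℂ) ^ p * trigExp a (1 / s))‖ := by simp
    _ ≤ ‖(p + 2 : ℂ) * (∫ s in (0 : ℝ)..h, (s : ℂ) ^ (p + 1) * trigExp a (1 / s))‖ +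
        ‖(h : ℂ) ^ (p + 2) * trigExp a (1 / h)‖ := by rw [hmain]; exact norm_sub_le _ _
    _ ≤ (p + 2) * (h ^ (p + 1) * h) + h ^ (p + 2) := by
        have : ‖(p + 2 : ℂ)‖ = p + 2 := by exact_mod_cast Complex.norm_natCast (p + 2)
        rw [norm_mul, this, norm_mul, norm_trigExp, norm_pow, Complex.norm_real,
          Real.norm_of_nonneg hh, mul_one]
        gcongr
    _ = (p + 3) * h ^ (p + 2) := by ring

theorem tendsto_integral_mul_trigExp_inv_div_pow {w : ℝ → ℝ} {L c a : ℝ} (hL : 0 < L) (ha : a ≠ 0)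
    {p : ℕ} (hw : ContinuousOn w (Set.Icc 0 L))
    (hwc : Tendsto (fun s => w s / s ^ p) (𝓝[>] 0) (𝓝 c)) :
    Tendsto (fun h : ℝ => (1 / h ^ (p + 1)) • ∫ s in (0 : ℝ)..h, (w s : ℂ) * trigExp a (1 / s))
      (𝓝[>] 0) (𝓝 0) := by
  rw [Metric.tendsto_nhds]
  intro ε hε
  have hK : Tendsto (fun h : ℝ => |c| * ((p + 3) / |a|) * h) (𝓝[>] 0) (𝓝 0) := by
    have : Continuous fun h : ℝ => |c| * ((p + 3) / |a|) * h := by fun_prop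
    simpa using (this.tendsto 0).mono_left nhdsWithin_le_nhds
  have hclose := (Metric.tendsto_nhds.1 hwc) (ε / 2) (half_pos hε)
  obtain ⟨δ, hδ, hδw⟩ := mem_nhdsGT_iff_exists_Ioo_subset.1 hclose
  filter_upwards [Ioo_mem_nhdsGT hδ, Ioc_mem_nhdsGT hL,
    hK.eventually_lt_const (half_pos hε)] with h hhδ hhL hKh
  have hh : 0 < h := hhδ.1
  have hint_pow : IntervalIntegrable (fun s : ℝ => (s : ℂ) ^ p * trigExp a (1 / s)) volume 0 h :=
    intervalIntegrable_mul_trigExp_inv a (Continuous.intervalIntegrable (by fun_prop) _ _)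
  have hint_w : IntervalIntegrable (fun s : ℝ => (w s : ℂ) * trigExp a (1 / s)) volume 0 h := by
    refine intervalIntegrable_mul_trigExp_inv a (ContinuousOn.intervalIntegrable ?_)
    rw [Set.uIcc_of_le hh.le]
    exact Complex.continuous_ofReal.comp_continuousOn
      (hw.mono (Set.Icc_subset_Icc_right hhL.2))
  have hsplit : ∫ s in (0 : ℝ)..h, (w s : ℂ) * trigExp a (1 / s) =
      (∫ s in (0 : ℝ)..h, ((w s : ℂ) * trigExp a (1 / s) -
        c * ((s : ℂ) ^ p * trigExp a (1 / s)))) +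
      c * ∫ s in (0 : ℝ)..h, (s : ℂ) ^ p * trigExp a (1 / s) := by
    rw [intervalIntegral.integral_sub hint_w (hint_pow.const_mul _),
      intervalIntegral.integral_const_mul, sub_add_cancel]
  have hfirst : ‖∫ s in (0 : ℝ)..h, ((w s : ℂ) * trigExp a (1 / s) -
      c * ((s : ℂ) ^ p * trigExp a (1 / s)))‖ ≤ ε / 2 * h ^ p * |h - 0| := by
    refine intervalIntegral.norm_integral_le_of_norm_le_const fun s hs => ?_
    rw [Set.uIoc_of_le hh.le] at hs
    have hsw : |w s / s ^ p - c| < ε / 2 := hδw ⟨hs.1, hs.2.trans_lt hhδ.2⟩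
    have hsp : 0 < s ^ p := pow_pos hs.1 p
    have hfactor : (w s : ℂ) * trigExp a (1 / s) - c * ((s : ℂ) ^ p * trigExp a (1 / s)) =
        (((w s / s ^ p - c) * s ^ p : ℝ) : ℂ) * trigExp a (1 / s) := by
      rw [sub_mul, div_mul_cancel₀ _ hsp.ne']
      push_cast
      ring
    rw [hfactor, norm_mul, norm_trigExp, mul_one, Complex.norm_real, Real.norm_eq_abs, abs_mul,
      abs_of_pos hsp]
    exact mul_le_mul hsw.le (pow_le_pow_left₀ hs.1.le hs.2 p) hsp.le (half_pos hε).le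
  have hsecond : ‖(c : ℂ) * ∫ s in (0 : ℝ)..h, (s : ℂ) ^ p * trigExp a (1 / s)‖ ≤
      (|c| * ((p + 3) / |a|) * h) * h ^ (p + 1) := by
    have := norm_integral_pow_mul_trigExp_inv_le a p hh.le
    rw [mul_comm, ← le_div_iff₀ (abs_pos.2 ha)] at this
    rw [norm_mul, Complex.norm_real, Real.norm_eq_abs]
    calc _ ≤ |c| * ((p + 3) * h ^ (p + 2) / |a|) := by gcongr
      _ = _ := by ring
  rw [sub_zero, abs_of_pos hh, mul_assoc, ← pow_succ] at hfirst
  have hpow : 0 < h ^ (p + 1) := pow_pos hh _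
  rw [dist_zero_right, norm_smul, Real.norm_eq_abs, abs_of_pos (by positivity), one_div_mul_eq_div,
    div_lt_iff₀ hpow, hsplit]
  calc _ ≤ ε / 2 * h ^ (p + 1) + (|c| * ((p + 3) / |a|) * h) * h ^ (p + 1) :=
        (norm_add_le _ _).trans (add_le_add hfirst hsecond)
    _ < ε / 2 * h ^ (p + 1) + ε / 2 * h ^ (p + 1) := by gcongr
    _ = ε * h ^ (p + 1) := by ring

/-- The average of `f ∘ u` over the interval from `0` to `T`. -/
noncomputable def averageAlong (u : ℝ → ℝ) (f : ℝ → ℂ) (T : ℝ) : ℂ :=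
  (1 / T) • ∫ x in (0 : ℝ)..T, f (u x)

theorem IsTrigPoly.continuous {P : ℝ → ℂ} (hP : IsTrigPoly P) : Continuous P := by
  obtain ⟨m, c, a, rfl⟩ := hP
  fun_prop

theorem IsTrigPoly.exists_norm_le {P : ℝ → ℂ} (hP : IsTrigPoly P) : ∃ C, ∀ x, ‖P x‖ ≤ C := by
  obtain ⟨m, c, a, rfl⟩ := hP
  refine ⟨∑ k, ‖c k‖, fun x => norm_sum_le_of_le _ fun k _ => ?_⟩
  rw [norm_mul, ← trigExp, norm_trigExp, mul_one]

theorem AlmostPeriodic.continuous {f : ℝ → ℂ} (hf : AlmostPeriodic f) : Continuous f := by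
  obtain ⟨P, hP, hPf⟩ := hf
  exact hPf.continuous (Frequently.of_forall fun k => (hP k).continuous)

theorem AlmostPeriodic.exists_norm_le {f : ℝ → ℂ} (hf : AlmostPeriodic f) :
    ∃ C, ∀ x, ‖f x‖ ≤ C := by
  obtain ⟨P, hP, hPf⟩ := hf
  obtain ⟨k, hk⟩ := (Metric.tendstoUniformly_iff.1 hPf 1 one_pos).exists
  obtain ⟨C, hC⟩ := (hP k).exists_norm_le
  refine ⟨1 + C, fun x => ?_⟩
  have h := hk x
  rw [dist_eq_norm] at h
  calc ‖f x‖ = ‖(f x - P k x) + P k x‖ := by rw [sub_add_cancel]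
    _ ≤ 1 + C := (norm_add_le _ _).trans (add_le_add h.le (hC x))

theorem intervalIntegrable_comp_of_norm_le {f : ℝ → ℂ} {u : ℝ → ℝ} {T C : ℝ} (hT : 0 ≤ T)
    (hf : Continuous f) (hC : ∀ x, ‖f x‖ ≤ C)
    (hu : AEMeasurable u (volume.restrict (Set.Ioc 0 T))) :
    IntervalIntegrable (fun x => f (u x)) volume 0 T := by
  rw [intervalIntegrable_iff_integrableOn_Ioc_of_le hT]
  exact IntegrableOn.of_bound (by simp) (hf.measurable.comp_aemeasurable hu).aestronglyMeasurable C
    (ae_of_all _ fun x => hC _)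

theorem tendsto_averageAlong_sum_trigExp {l : Filter ℝ} {u : ℝ → ℝ}
    (hu : ∀ᶠ T in l, 0 < T ∧ AEMeasurable u (volume.restrict (Set.Ioc 0 T)))
    (htrig : ∀ a, Tendsto (averageAlong u (trigExp a)) l (𝓝 (if a = 0 then 1 else 0)))
    {m : ℕ} (c : Fin m → ℂ) (a : Fin m → ℝ) :
    Tendsto (averageAlong u fun x => ∑ k, c k * trigExp (a k) x) l
      (𝓝 (∑ k, c k * if a k = 0 then 1 else 0)) := by
  refine (tendsto_finsetSum _ fun k _ => (htrig (a k)).const_mul (c k)).congr' ?_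
  filter_upwards [hu] with T hT
  simp only [averageAlong]
  rw [intervalIntegral.integral_finsetSum, Finset.smul_sum]
  · refine Finset.sum_congr rfl fun k _ => ?_
    rw [intervalIntegral.integral_const_mul, mul_smul_comm]
  · intro k _
    exact (intervalIntegrable_comp_of_norm_le hT.1.le (continuous_trigExp _)
      (fun x => (norm_trigExp _ x).le) hT.2).const_mul _

theorem norm_averageAlong_sub_le {f P : ℝ → ℂ} {u : ℝ → ℝ} {T ε : ℝ} (hT : 0 < T)
    (hf : IntervalIntegrable (fun x => f (u x)) volume 0 T)
    (hP : IntervalIntegrable (fun x => P (u x)) volume 0 T) (hε : ∀ x, ‖f x - P x‖ ≤ ε) :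
    ‖averageAlong u f T - averageAlong u P T‖ ≤ ε := by
  rw [averageAlong, averageAlong, ← smul_sub, ← intervalIntegral.integral_sub hf hP, norm_smul,
    Real.norm_of_nonneg (by positivity), one_div_mul_eq_div, div_le_iff₀ hT]
  simpa [abs_of_pos hT] using intervalIntegral.norm_integral_le_of_norm_le_const
    (a := 0) (b := T) fun x _ => hε (u x)

theorem tendstoUniformlyOnFilter_averageAlong {f : ℝ → ℂ} (hf : AlmostPeriodic f)
    {P : ℕ → ℝ → ℂ} (hP : ∀ k, IsTrigPoly (P k)) (hPf : TendstoUniformly P f atTop)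
    {l : Filter ℝ} {u : ℝ → ℝ}
    (hu : ∀ᶠ T in l, 0 < T ∧ AEMeasurable u (volume.restrict (Set.Ioc 0 T))) :
    TendstoUniformlyOnFilter (fun k => averageAlong u (P k)) (averageAlong u f) atTop l := by
  rw [Metric.tendstoUniformlyOnFilter_iff]
  intro ε hε
  filter_upwards [(Metric.tendstoUniformly_iff.1 hPf (ε / 2) (half_pos hε)).prod_mk hu]
    with ⟨k, T⟩ ⟨hk, hT, huT⟩
  obtain ⟨C, hC⟩ := hf.exists_norm_le
  obtain ⟨C', hC'⟩ := (hP k).exists_norm_le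
  rw [dist_eq_norm]
  refine (norm_averageAlong_sub_le hT
    (intervalIntegrable_comp_of_norm_le hT.le hf.continuous hC huT)
    (intervalIntegrable_comp_of_norm_le hT.le (hP k).continuous hC' huT)
    fun x => ?_).trans_lt (half_lt_self hε)
  rw [← dist_eq_norm]
  exact (hk x).le

theorem tendsto_limit_of_tendstoUniformlyOnFilter {l : Filter ℝ} [l.NeBot] {F : ℕ → ℝ → ℂ}
    {f : ℝ → ℂ} {L : ℕ → ℂ} {M : ℂ} (hF : TendstoUniformlyOnFilter F f atTop l)
    (hL : ∀ k, Tendsto (F k) l (𝓝 (L k))) (hM : Tendsto f l (𝓝 M)) :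
    Tendsto L atTop (𝓝 M) := by
  rw [Metric.tendsto_nhds]
  intro ε hε
  filter_upwards [(Metric.tendstoUniformlyOnFilter_iff.1 hF (ε / 2) (half_pos hε)).curry] with k hk
  refine (le_of_tendsto ((hL k).dist hM) ?_).trans_lt (half_lt_self hε)
  filter_upwards [hk] with T hT
  rw [dist_comm]
  exact hT.le

/-- The mean value of an almost periodic function is the same along any two ways of averaging that
agree on characters. -/
theorem AlmostPeriodic.tendsto_averageAlong {f : ℝ → ℂ} (hf : AlmostPeriodic f)
    {l l' : Filter ℝ} [l.NeBot] {u v : ℝ → ℝ}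
    (hu : ∀ᶠ T in l, 0 < T ∧ AEMeasurable u (volume.restrict (Set.Ioc 0 T)))
    (hv : ∀ᶠ T in l', 0 < T ∧ AEMeasurable v (volume.restrict (Set.Ioc 0 T)))
    (hutrig : ∀ a, Tendsto (averageAlong u (trigExp a)) l (𝓝 (if a = 0 then 1 else 0)))
    (hvtrig : ∀ a, Tendsto (averageAlong v (trigExp a)) l' (𝓝 (if a = 0 then 1 else 0)))
    {M : ℂ} (hM : Tendsto (averageAlong u f) l (𝓝 M)) :
    Tendsto (averageAlong v f) l' (𝓝 M) := by
  obtain ⟨P, hP, hPf⟩ := id hf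
  choose m c a hPeq using hP
  have hPu k := tendsto_averageAlong_sum_trigExp hu hutrig (c k) (a k)
  have hPv k := tendsto_averageAlong_sum_trigExp hv hvtrig (c k) (a k)
  have hP k : IsTrigPoly (P k) := ⟨m k, c k, a k, hPeq k⟩
  have heq k : P k = fun x => ∑ j, c k j * trigExp (a k j) x := hPeq k
  simp only [← heq] at hPu hPv
  exact (tendstoUniformlyOnFilter_averageAlong hf hP hPf hv).tendsto_of_eventually_tendsto
    (Eventually.of_forall hPv) (tendsto_limit_of_tendstoUniformlyOnFilter
      (tendstoUniformlyOnFilter_averageAlong hf hP hPf hu) hPu hM)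

theorem tendsto_averageAlong_trigExp_zero {l : Filter ℝ} {u : ℝ → ℝ} (hl : ∀ᶠ T in l, 0 < T) :
    Tendsto (averageAlong u (trigExp 0)) l (𝓝 1) := by
  refine tendsto_const_nhds.congr' ?_
  filter_upwards [hl] with T hT
  simp [averageAlong, trigExp_zero_left, hT.ne']

theorem tendsto_averageAlong_id_trigExp (a : ℝ) :
    Tendsto (averageAlong id (trigExp a)) atTop (𝓝 (if a = 0 then 1 else 0)) := by
  split_ifs with ha
  · subst ha
    exact tendsto_averageAlong_trigExp_zero (eventually_gt_atTop 0)
  have hc : Complex.I * a ≠ 0 := by simp [ha]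
  have hbound : Tendsto (fun T : ℝ => T⁻¹ * (2 / |a|)) atTop (𝓝 0) := by
    simpa using tendsto_inv_atTop_zero.mul_const (2 / |a|)
  refine squeeze_zero_norm' ?_ hbound
  filter_upwards [eventually_gt_atTop 0] with T hT
  have heq (x : ℝ) : trigExp a x = Complex.exp (Complex.I * a * x) := by
    simp [trigExp, mul_assoc]
  simp only [averageAlong, id, heq, integral_exp_mul_complex hc]
  rw [norm_smul, norm_div (_ - _), Real.norm_of_nonneg (one_div_pos.2 hT).le, one_div]
  have hnorm : ‖Complex.I * a‖ = |a| := by simp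
  rw [hnorm, ← heq, ← heq]
  gcongr
  exact (norm_sub_le _ _).trans (by rw [norm_trigExp, norm_trigExp]; norm_num)

theorem integral_comp_inv_of_leftInverse {lam nu : ℝ → ℝ}
    (hlam_cont : ContinuousOn lam (Set.Icc 0 1)) (hlam_mono : StrictMonoOn lam (Set.Icc 0 1))
    (hlam0 : lam 0 = 0) (hinv1 : ∀ t ∈ Set.Icc (0 : ℝ) 1, nu (lam t) = t)
    (hinv2 : ∀ s ∈ Set.Icc (0 : ℝ) (lam 1), lam (nu s) = s)
    (hnu : DifferentiableOn ℝ nu (Set.Icc 0 (lam 1))) (f : ℝ → ℂ) {η : ℝ}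
    (hη : η ∈ Set.Ioc (0 : ℝ) 1) :
    ∫ ε in (0 : ℝ)..η, f (1 / lam ε) =
      ∫ s in (0 : ℝ)..lam η, ((|derivWithin nu (Set.Icc 0 (lam 1)) s| : ℝ) : ℂ) * f (1 / s) := by
  have hη' : η ∈ Set.Icc (0 : ℝ) 1 := Set.Ioc_subset_Icc_self hη
  have hsub : Set.Icc (0 : ℝ) η ⊆ Set.Icc 0 1 := Set.Icc_subset_Icc_right hη.2
  have hlamη : 0 ≤ lam η := hlam0 ▸ hlam_mono.monotoneOn ⟨le_rfl, zero_le_one⟩ hη' hη.1.le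
  have hle : lam η ≤ lam 1 := hlam_mono.monotoneOn hη' ⟨zero_le_one, le_rfl⟩ hη.2
  have hsubL : Set.Ioc 0 (lam η) ⊆ Set.Icc 0 (lam 1) :=
    fun s hs => ⟨hs.1.le, hs.2.trans hle⟩
  have himage_lam : lam '' Set.Ioc 0 η = Set.Ioc 0 (lam η) := by
    simpa only [hlam0] using
      (hlam_cont.mono hsub).image_Ioc_of_strictMonoOn hη.1.le (hlam_mono.mono hsub)
  have himage : nu '' Set.Ioc 0 (lam η) = Set.Ioc 0 η := by
    rw [← himage_lam, Set.image_image]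
    refine (Set.image_congr fun t ht => ?_).trans (Set.image_id _)
    exact hinv1 t (hsub (Set.Ioc_subset_Icc_self ht))
  have hinj : Set.InjOn nu (Set.Ioc 0 (lam η)) := fun s hs t ht hst => by
    rw [← hinv2 s (hsubL hs), hst, hinv2 t (hsubL ht)]
  rw [intervalIntegral.integral_of_le hη.1.le, intervalIntegral.integral_of_le hlamη, ← himage,
    integral_image_eq_integral_abs_deriv_smul measurableSet_Ioc
      (fun s hs => ((hnu s (hsubL hs)).hasDerivWithinAt.mono hsubL)) hinj]
  refine setIntegral_congr_fun measurableSet_Ioc fun s hs => ?_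
  simp only [hinv2 s (hsubL hs), Complex.real_smul]

theorem tendsto_averageAlong_inv_trigExp {lam nu : ℝ → ℝ}
    (hlam_cont : ContinuousOn lam (Set.Icc 0 1)) (hlam_mono : StrictMonoOn lam (Set.Icc 0 1))
    (hlam0 : lam 0 = 0) (hinv1 : ∀ t ∈ Set.Icc (0 : ℝ) 1, nu (lam t) = t)
    (hinv2 : ∀ s ∈ Set.Icc (0 : ℝ) (lam 1), lam (nu s) = s) {q : ℕ} (hq : 1 ≤ q)
    (hnu_smooth : ContDiffOn ℝ q nu (Set.Icc 0 (lam 1)))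
    (hnu_jzero : ∀ j : ℕ, 1 ≤ j → j < q → iteratedDerivWithin j nu (Set.Icc 0 (lam 1)) 0 = 0)
    (hnu_q : iteratedDerivWithin q nu (Set.Icc 0 (lam 1)) 0 ≠ 0) (a : ℝ) :
    Tendsto (averageAlong (fun ε => 1 / lam ε) (trigExp a)) (𝓝[>] 0)
      (𝓝 (if a = 0 then 1 else 0)) := by
  split_ifs with ha
  · subst ha
    exact tendsto_averageAlong_trigExp_zero self_mem_nhdsWithin
  obtain ⟨p, rfl⟩ : ∃ p, q = p + 1 := ⟨q - 1, by omega⟩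
  have h01 : (0 : ℝ) ∈ Set.Icc (0 : ℝ) 1 := ⟨le_rfl, zero_le_one⟩
  have hL : 0 < lam 1 := hlam0 ▸ hlam_mono h01 ⟨zero_le_one, le_rfl⟩ one_pos
  have hnu0 : nu 0 = 0 := by simpa [hlam0] using hinv1 0 h01
  have hderiv := (contDiffOn_succ_iff_derivWithin (n := p) (uniqueDiffOn_Icc hL)).1
    (by exact_mod_cast hnu_smooth)
  have hnu_lim := tendsto_div_pow_of_iteratedDerivWithin_eq_zero hL hnu_smooth fun j hj => by
    rcases Nat.eq_zero_or_pos j with rfl | hj0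
    · simpa using hnu0
    · exact hnu_jzero j hj0 hj
  have hnu'_lim := tendsto_div_pow_of_iteratedDerivWithin_eq_zero hL hderiv.2.2 fun j hj => by
    rw [← iteratedDerivWithin_succ']
    exact hnu_jzero (j + 1) (by omega) (by omega)
  have habs_lim : Tendsto (fun s => |derivWithin nu (Set.Icc 0 (lam 1)) s| / s ^ p) (𝓝[>] 0)
      (𝓝 |iteratedDerivWithin p (derivWithin nu (Set.Icc 0 (lam 1))) (Set.Icc 0 (lam 1)) 0 /
        p.factorial|) := by
    refine hnu'_lim.abs.congr' ?_
    filter_upwards [self_mem_nhdsWithin] with s hs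
    rw [abs_div, abs_of_pos (pow_pos (Set.mem_Ioi.1 hs) p : 0 < s ^ p)]
  have hweighted := tendsto_integral_mul_trigExp_inv_div_pow hL ha
    hderiv.2.2.continuousOn.abs habs_lim
  have hlam_lim : Tendsto lam (𝓝[>] 0) (𝓝[>] 0) := by
    refine tendsto_nhdsWithin_iff.2 ⟨?_, ?_⟩
    · have := (hlam_cont 0 h01).mono Set.Ioc_subset_Icc_self
      rwa [ContinuousWithinAt, hlam0, nhdsWithin_Ioc_eq_nhdsGT one_pos] at this
    · filter_upwards [Ioc_mem_nhdsGT one_pos] with t ht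
      exact hlam0 ▸ hlam_mono h01 (Set.Ioc_subset_Icc_self ht) ht.1
  have hprod := ((hnu_lim.inv₀ (div_ne_zero hnu_q (by positivity))).smul hweighted).comp hlam_lim
  rw [smul_zero] at hprod
  refine hprod.congr' ?_
  filter_upwards [Ioc_mem_nhdsGT one_pos, hlam_lim self_mem_nhdsWithin] with η hη hlamη
  have hpow : (lam η) ^ (p + 1) ≠ 0 := (pow_pos hlamη _).ne'
  rw [averageAlong, integral_comp_inv_of_leftInverse hlam_cont hlam_mono hlam0 hinv1 hinv2
    hderiv.1 _ hη, Function.comp_apply, hinv1 η (Set.Ioc_subset_Icc_self hη), smul_smul]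
  congr 1
  field_simp

theorem tendsto_average_mul_zero {r : ℝ → ℝ} {F : ℝ → ℂ} {C : ℝ} (hC : ∀ x, ‖F x‖ ≤ C)
    (hr : Tendsto r (𝓝[>] 0) (𝓝 0)) :
    Tendsto (fun η : ℝ => (1 / η) • ∫ ε in (0 : ℝ)..η, (r ε : ℂ) * F ε) (𝓝[>] 0) (𝓝 0) := by
  have hC0 : 0 ≤ C := (norm_nonneg _).trans (hC 0)
  rw [Metric.tendsto_nhds]
  intro κ hκ
  have hκC : 0 < κ / (C + 1) := by positivity
  obtain ⟨δ, hδ, hδr⟩ := mem_nhdsGT_iff_exists_Ioo_subset.1 (Metric.tendsto_nhds.1 hr _ hκC)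
  filter_upwards [Ioo_mem_nhdsGT hδ] with η hη
  have hbound : ‖∫ ε in (0 : ℝ)..η, (r ε : ℂ) * F ε‖ ≤ κ / (C + 1) * C * |η - 0| := by
    refine intervalIntegral.norm_integral_le_of_norm_le_const fun ε hε => ?_
    rw [Set.uIoc_of_le hη.1.le] at hε
    have hrε := hδr ⟨hε.1, hε.2.trans_lt hη.2⟩
    simp only [Set.mem_ofPred_eq, dist_zero_right] at hrε
    rw [norm_mul, Complex.norm_real]
    exact mul_le_mul hrε.le (hC ε) (norm_nonneg _) hκC.le
  rw [sub_zero, abs_of_pos hη.1] at hbound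
  rw [dist_zero_right, norm_smul, Real.norm_of_nonneg (one_div_pos.2 hη.1).le, one_div_mul_eq_div,
    div_lt_iff₀ hη.1]
  refine hbound.trans_lt (mul_lt_mul_of_pos_right ?_ hη.1)
  rw [div_mul_eq_mul_div, div_lt_iff₀ (by positivity)]
  linarith [mul_add κ C 1]

/-- For `f` almost periodic with mean value `M`, `λ` as in Statement 4, and
`g : (0,1] → ℝ` measurable, bounded, with `g(ε) → g₀` as `ε → 0⁺`, we have
`lim_{η→0⁺} (1/η) ∫₀^η g(ε) f(1/λ(ε)) dε = g₀ · M(f)`. -/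
theorem avg_of_g_mul_f_comp_inv_lambda (f : ℝ → ℂ) (hf : AlmostPeriodic f)
    (lam nu : ℝ → ℝ)
    (hlam_cont : ContinuousOn lam (Set.Icc 0 1))
    (hlam_mono : StrictMonoOn lam (Set.Icc 0 1))
    (hlam0 : lam 0 = 0)
    (hlam_nonneg : ∀ t ∈ Set.Icc (0:ℝ) 1, 0 ≤ lam t)
    (hinv1 : ∀ t ∈ Set.Icc (0:ℝ) 1, nu (lam t) = t)
    (hinv2 : ∀ s ∈ Set.Icc (0:ℝ) (lam 1), lam (nu s) = s)
    (q : ℕ) (hq : 1 ≤ q)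
    (hnu_smooth : ContDiffOn ℝ (q + 1 : ℕ) nu (Set.Icc 0 (lam 1)))
    (hnu_jzero : ∀ j : ℕ, 1 ≤ j → j < q → iteratedDerivWithin j nu (Set.Icc 0 (lam 1)) 0 = 0)
    (hnu_q : iteratedDerivWithin q nu (Set.Icc 0 (lam 1)) 0 ≠ 0)
    (g : ℝ → ℝ) (hgm : Measurable g) (hgb : ∃ C : ℝ, ∀ ε ∈ Set.Ioc (0:ℝ) 1, |g ε| ≤ C)
    (g₀ : ℝ) (hg₀ : Tendsto g (𝓝[>] 0) (𝓝 g₀))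
    (M : ℂ)
    (hM : Tendsto (fun T : ℝ => (1 / T) • ∫ x in (0:ℝ)..T, f x) atTop (𝓝 M)) :
    Tendsto (fun η : ℝ => (1 / η) • ∫ ε in (0:ℝ)..η, (g ε : ℂ) * f (1 / lam ε))
      (𝓝[>] 0) (𝓝 ((g₀ : ℂ) * M)) := by
  obtain ⟨C, hC⟩ := hf.exists_norm_le
  obtain ⟨D, hD⟩ := hgb
  have hlam_meas {η : ℝ} (hη : η ∈ Set.Ioc (0 : ℝ) 1) :
      AEMeasurable (fun ε => 1 / lam ε) (volume.restrict (Set.Ioc 0 η)) :=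
    ((hlam_cont.mono ((Set.Ioc_subset_Ioc_right hη.2).trans
      Set.Ioc_subset_Icc_self)).aemeasurable measurableSet_Ioc).const_div 1
  have hmean : Tendsto (averageAlong (fun ε => 1 / lam ε) f) (𝓝[>] 0) (𝓝 M) :=
    hf.tendsto_averageAlong (u := id)
      ((eventually_gt_atTop 0).mono fun T hT => ⟨hT, aemeasurable_id⟩)
      (mem_of_superset (Ioc_mem_nhdsGT one_pos) fun η hη => ⟨hη.1, hlam_meas hη⟩)
      tendsto_averageAlong_id_trigExp
      (tendsto_averageAlong_inv_trigExp hlam_cont hlam_mono hlam0 hinv1 hinv2 hq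
        (hnu_smooth.of_le (by exact_mod_cast q.le_succ)) hnu_jzero hnu_q) hM
  have hrem := tendsto_average_mul_zero (r := fun ε => g ε - g₀) (F := fun ε => f (1 / lam ε))
    (fun ε => hC _) (by simpa using hg₀.sub_const g₀)
  have hsum := hrem.add (hmean.const_mul (g₀ : ℂ))
  rw [zero_add] at hsum
  refine hsum.congr' ?_
  filter_upwards [Ioc_mem_nhdsGT one_pos] with η hη
  have hint : IntervalIntegrable (fun ε => f (1 / lam ε)) volume 0 η :=
    intervalIntegrable_comp_of_norm_le hη.1.le hf.continuous hC (hlam_meas hη)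
  have hint_g : IntervalIntegrable (fun ε => (g ε : ℂ) * f (1 / lam ε)) volume 0 η := by
    rw [intervalIntegrable_iff_integrableOn_Ioc_of_le hη.1.le] at hint ⊢
    refine hint.bdd_mul (c := D) (by fun_prop) ?_
    filter_upwards [ae_restrict_mem measurableSet_Ioc] with ε hε
    simpa using hD ε ⟨hε.1, hε.2.trans hη.2⟩
  simp only [Complex.ofReal_sub, sub_mul]
  rw [averageAlong, intervalIntegral.integral_sub hint_g (hint.const_mul _),
    intervalIntegral.integral_const_mul, mul_smul_comm, ← smul_add, sub_add_cancel]
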